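/- arXiv:1910.01099 — 8 statements merged into one kernel-verified Lean document; each statement's English description precedes it below -/
import Mathlib

section
/- Let G be a finite simple graph and k a natural number. Let G' be the 2-edge-coloured graph with vertex set V(G) ⊎ {v' : v ∈ V(G)}, whose blue edges are the pairs uv with uv ∈ E(G), and whose red edges are the pairs vv' for v ∈ V(G). Then G has a vertex cover of size at most k if and only if there is a set S of at most k edges of G' such that G' − S admits a homomorphism to H^{2b}_{r,b}. -/
/-- Red edges of the gadget graph `G'` of Statement 5: a red edge `v v'` for each
vertex `v` of `G` (original vertices are `Sum.inl`, primed copies `Sum.inr`). -/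
def R5 {V : Type} : (V ⊕ V) → (V ⊕ V) → Prop
  | Sum.inl u, Sum.inr v => u = v
  | Sum.inr u, Sum.inl v => u = v
  | _, _ => False

/-- Blue edges of the gadget graph `G'` of Statement 5: a blue copy of each edge
of `G`. -/
def B5 {V : Type} (G : SimpleGraph V) : (V ⊕ V) → (V ⊕ V) → Prop
  | Sum.inl u, Sum.inl v => G.Adj u v
  | _, _ => False

/-- An edge of a 2-edge-coloured graph with red relation `R` and blue relation `B`:
a pair of a colour (`true` = red, `false` = blue) and an unordered pair of vertices
for which the corresponding relation holds. -/
def IsECEdge {V : Type} (R B : V → V → Prop) (p : Bool × Sym2 V) : Prop :=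
  ∃ u v : V, p.2 = s(u, v) ∧ ((p.1 = true ∧ R u v) ∨ (p.1 = false ∧ B u v))

/-- Every edge of the gadget graph has an endpoint among the original vertices. -/
theorem exists_inl_mem_of_isECEdge {V : Type} {G : SimpleGraph V} {p : Bool × Sym2 (V ⊕ V)}
    (hp : IsECEdge R5 (B5 G) p) : ∃ w : V, Sum.inl w ∈ p.2 := by
  obtain ⟨x, y, hxy, h⟩ := hp
  rw [hxy]
  rcases x with u | u
  · exact ⟨u, Sym2.mem_mk_left _ _⟩
  · rcases y with v | v
    · exact ⟨v, Sym2.mem_mk_right _ _⟩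
    · simp [R5, B5] at h

/-- `G` has a vertex cover of size at most `k` iff at most `k` edges
can be deleted from the gadget graph `G'` so that the resulting graph admits a
homomorphism to `H^{2b}_{r,b}` (red loop at `0`, blue loop at `1`, blue edge
between `0` and `1`). -/
theorem stmt5 (V : Type) [Fintype V] [DecidableEq V] (G : SimpleGraph V) (k : ℕ) :
    (∃ C : Finset V, C.card ≤ k ∧ ∀ u v, G.Adj u v → u ∈ C ∨ v ∈ C) ↔
      (∃ S : Finset (Bool × Sym2 (V ⊕ V)), S.card ≤ k ∧
        (∀ p ∈ S, IsECEdge R5 (B5 G) p) ∧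
        ∃ φ : (V ⊕ V) → Fin 2,
          (∀ x y, R5 x y → (true, s(x, y)) ∉ S → φ x = 0 ∧ φ y = 0) ∧
          (∀ x y, B5 G x y → (false, s(x, y)) ∉ S →
            ((φ x = 1 ∧ φ y = 1) ∨ (φ x = 0 ∧ φ y = 1) ∨ (φ x = 1 ∧ φ y = 0)))) := by
  constructor
  · rintro ⟨C, hCk, hC⟩
    refine ⟨C.image fun v => (true, s(Sum.inl v, Sum.inr v)),
      Finset.card_image_le.trans hCk, ?_, Sum.elim (fun v => if v ∈ C then 1 else 0) 0, ?_, ?_⟩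
    · intro p hp
      obtain ⟨v, -, rfl⟩ := Finset.mem_image.1 hp
      exact ⟨Sum.inl v, Sum.inr v, rfl, Or.inl ⟨rfl, rfl⟩⟩
    · rintro (u | u) (v | v) h hS <;> simp_all [R5]
    · rintro (u | u) (v | v) h - <;> simp only [B5] at h
      have := hC u v h
      by_cases hu : u ∈ C <;> by_cases hv : v ∈ C <;> simp_all
  · rintro ⟨S, hSk, hS, φ, hR, hB⟩
    rcases isEmpty_or_nonempty V with _ | _
    · exact ⟨∅, by simp, fun u => isEmptyElim u⟩
    choose! f hf using fun p hp => exists_inl_mem_of_isECEdge (hS p hp)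
    have mem_cover {u : V} (hu : φ (Sum.inl u) = 1) : u ∈ S.image f := by
      have h : (true, s(Sum.inl u, Sum.inr u)) ∈ S := by
        by_contra h
        simp [(hR (Sum.inl u) (Sum.inr u) rfl h).1] at hu
      have hfu := hf _ h
      simp only [Sym2.mem_iff, Sum.inl.injEq, reduceCtorEq, or_false] at hfu
      exact Finset.mem_image.2 ⟨_, h, hfu⟩
    refine ⟨S.image f, Finset.card_image_le.trans hSk, fun u v huv => ?_⟩
    by_cases h : (false, s(Sum.inl u, Sum.inl v)) ∈ S
    · have hfuv := hf _ h
      simp only [Sym2.mem_iff, Sum.inl.injEq] at hfuv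
      exact hfuv.imp (fun e => Finset.mem_image.2 ⟨_, h, e⟩) fun e => Finset.mem_image.2 ⟨_, h, e⟩
    · rcases hB (Sum.inl u) (Sum.inl v) huv h with ⟨hu, -⟩ | ⟨-, hv⟩ | ⟨hu, -⟩
      · exact Or.inl (mem_cover hu)
      · exact Or.inr (mem_cover hv)
      · exact Or.inl (mem_cover hu)
end

section
/- Let G be a finite simple graph and k a natural number. Let G' be the 2-edge-coloured graph with vertex set V(G) ⊎ {v' : v ∈ V(G)} ⊎ {x_e, y_e, z_e : e ∈ E(G)}, whose red edges are: uv for every edge uv ∈ E(G); u'x_e and v'x_e for every edge e = uv ∈ E(G); and y_e z_e for every e ∈ E(G); and whose blue edges are: vv' for every v ∈ V(G); and x_e y_e and x_e z_e for every e ∈ E(G). Then G has a vertex cover of size at most k if and only if there is a set S of at most k edges of G' such that G' − S admits a homomorphism to H^{2rb}_{r,b}. -/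
/-- Red edges of the gadget graph `G'` of Statement 6.  Vertices: `Sum.inl u` is an
original vertex `u` of `G`, `Sum.inr (Sum.inl u)` is the primed copy `u'`, and
`Sum.inr (Sum.inr (e, 0/1/2))` are the vertices `x_e, y_e, z_e` for each edge `e`
of `G`.  Red edges: `uv` for each edge `uv` of `G`; `u' x_e` and `v' x_e` for each
edge `e = uv`; and `y_e z_e`. -/
def R6 {V : Type} (G : SimpleGraph V) :
    (V ⊕ (V ⊕ (G.edgeSet × Fin 3))) → (V ⊕ (V ⊕ (G.edgeSet × Fin 3))) → Prop
  | Sum.inl u, Sum.inl v => G.Adj u v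
  | Sum.inr (Sum.inl w), Sum.inr (Sum.inr (e, i)) => i = 0 ∧ w ∈ e.1
  | Sum.inr (Sum.inr (e, i)), Sum.inr (Sum.inl w) => i = 0 ∧ w ∈ e.1
  | Sum.inr (Sum.inr (e, i)), Sum.inr (Sum.inr (f, j)) =>
      e = f ∧ ((i = 1 ∧ j = 2) ∨ (i = 2 ∧ j = 1))
  | _, _ => False

/-- Blue edges of the gadget graph `G'` of Statement 6: `v v'` for each vertex `v`
of `G`, and `x_e y_e`, `x_e z_e` for each edge `e` of `G`. -/
def B6 {V : Type} (G : SimpleGraph V) :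
    (V ⊕ (V ⊕ (G.edgeSet × Fin 3))) → (V ⊕ (V ⊕ (G.edgeSet × Fin 3))) → Prop
  | Sum.inl u, Sum.inr (Sum.inl v) => u = v
  | Sum.inr (Sum.inl u), Sum.inl v => u = v
  | Sum.inr (Sum.inr (e, i)), Sum.inr (Sum.inr (f, j)) =>
      e = f ∧ ((i = 0 ∧ (j = 1 ∨ j = 2)) ∨ ((i = 1 ∨ i = 2) ∧ j = 0))
  | _, _ => False

/-- Sends `v` and `v'` to `v`, and the vertices `x_e, y_e, z_e` to an endpoint of `e`. -/
noncomputable def gadgetBase {V : Type} (G : SimpleGraph V) :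
    (V ⊕ (V ⊕ (G.edgeSet × Fin 3))) → V
  | Sum.inl u => u
  | Sum.inr (Sum.inl u) => u
  | Sum.inr (Sum.inr (e, _)) => (Quot.out e.1).1

/-- An edge set whose deletion leaves a graph mapping to `H^{2rb}_{r,b}` yields a vertex cover
that is no larger. -/
theorem exists_cover_of_deletion {V : Type} [DecidableEq V] (G : SimpleGraph V)
    (S : Finset (Bool × Sym2 (V ⊕ (V ⊕ (G.edgeSet × Fin 3)))))
    (φ : (V ⊕ (V ⊕ (G.edgeSet × Fin 3))) → Fin 2)
    (hR : ∀ x y, R6 G x y → (true, s(x, y)) ∉ S →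
      ((φ x = 0 ∧ φ y = 0) ∨ (φ x = 0 ∧ φ y = 1) ∨ (φ x = 1 ∧ φ y = 0)))
    (hB : ∀ x y, B6 G x y → (false, s(x, y)) ∉ S →
      ((φ x = 1 ∧ φ y = 1) ∨ (φ x = 0 ∧ φ y = 1) ∨ (φ x = 1 ∧ φ y = 0))) :
    ∃ C : Finset V, C.card ≤ S.card ∧ ∀ u v, G.Adj u v → u ∈ C ∨ v ∈ C := by
  refine ⟨S.image fun p => gadgetBase G (Quot.out p.2).1, Finset.card_image_le, ?_⟩
  intro u v huv
  by_contra! hC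
  obtain ⟨hu, hv⟩ := hC
  have hS : ∀ c x y, (gadgetBase G x = u ∨ gadgetBase G x = v) →
      (gadgetBase G y = u ∨ gadgetBase G y = v) → (c, s(x, y)) ∉ S := by
    intro c x y hx hy hmem
    have himg := Finset.mem_image_of_mem (fun p => gadgetBase G (Quot.out p.2).1) hmem
    have hout : (Quot.out s(x, y)).1 = x ∨ (Quot.out s(x, y)).1 = y :=
      Sym2.mem_iff.mp (Sym2.out_fst_mem _)
    grind
  let e : G.edgeSet := ⟨s(u, v), huv⟩
  have he : ∀ i, gadgetBase G (.inr (.inr (e, i))) = u ∨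
      gadgetBase G (.inr (.inr (e, i))) = v := fun _ =>
    Sym2.mem_iff.mp (Sym2.out_fst_mem s(u, v))
  have huv_red := hR (.inl u) (.inl v) huv (hS _ _ _ (.inl rfl) (.inr rfl))
  have hu_blue := hB (.inl u) (.inr (.inl u)) rfl (hS _ _ _ (.inl rfl) (.inl rfl))
  have hv_blue := hB (.inl v) (.inr (.inl v)) rfl (hS _ _ _ (.inr rfl) (.inr rfl))
  have hux_red := hR (.inr (.inl u)) (.inr (.inr (e, 0))) ⟨rfl, Sym2.mem_mk_left u v⟩
    (hS _ _ _ (.inl rfl) (he 0))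
  have hvx_red := hR (.inr (.inl v)) (.inr (.inr (e, 0))) ⟨rfl, Sym2.mem_mk_right u v⟩
    (hS _ _ _ (.inr rfl) (he 0))
  have hxy_blue := hB (.inr (.inr (e, 0))) (.inr (.inr (e, 1))) ⟨rfl, .inl ⟨rfl, .inl rfl⟩⟩
    (hS _ _ _ (he 0) (he 1))
  have hxz_blue := hB (.inr (.inr (e, 0))) (.inr (.inr (e, 2))) ⟨rfl, .inl ⟨rfl, .inr rfl⟩⟩
    (hS _ _ _ (he 0) (he 2))
  have hyz_red := hR (.inr (.inr (e, 1))) (.inr (.inr (e, 2))) ⟨rfl, .inl ⟨rfl, rfl⟩⟩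
    (hS _ _ _ (he 1) (he 2))
  clear hR hB hS he hu hv
  clear_value e
  grind (splits := 30)

/-- The homomorphism associated with a vertex cover `C`: the vertices outside `C` and all `x_e`
are sent to `1`, everything else to `0`. -/
def coverHom {V : Type} [DecidableEq V] (G : SimpleGraph V) (C : Finset V) :
    (V ⊕ (V ⊕ (G.edgeSet × Fin 3))) → Fin 2
  | Sum.inl u => if u ∈ C then 0 else 1
  | Sum.inr (Sum.inl _) => 0
  | Sum.inr (Sum.inr (_, i)) => if i = 0 then 1 else 0

/-- `G` has a vertex cover of size at most `k` iff at most `k` edges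
can be deleted from the gadget graph `G'` so that the resulting graph admits a
homomorphism to `H^{2rb}_{r,b}` (red loop at `0`, blue loop at `1`, and both a red
and a blue edge between `0` and `1`). -/
theorem stmt6 (V : Type) [Fintype V] [DecidableEq V] (G : SimpleGraph V) (k : ℕ) :
    (∃ C : Finset V, C.card ≤ k ∧ ∀ u v, G.Adj u v → u ∈ C ∨ v ∈ C) ↔
      (∃ S : Finset (Bool × Sym2 (V ⊕ (V ⊕ (G.edgeSet × Fin 3)))), S.card ≤ k ∧
        (∀ p ∈ S, IsECEdge (R6 G) (B6 G) p) ∧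
        ∃ φ : (V ⊕ (V ⊕ (G.edgeSet × Fin 3))) → Fin 2,
          (∀ x y, R6 G x y → (true, s(x, y)) ∉ S →
            ((φ x = 0 ∧ φ y = 0) ∨ (φ x = 0 ∧ φ y = 1) ∨ (φ x = 1 ∧ φ y = 0))) ∧
          (∀ x y, B6 G x y → (false, s(x, y)) ∉ S →
            ((φ x = 1 ∧ φ y = 1) ∨ (φ x = 0 ∧ φ y = 1) ∨ (φ x = 1 ∧ φ y = 0)))) := by
  constructor
  · rintro ⟨C, hCk, hC⟩
    classical
    refine ⟨C.image fun v => (false, s(.inl v, .inr (.inl v))),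
      Finset.card_image_le.trans hCk, ?_, coverHom G C, ?_, ?_⟩
    · intro p hp
      obtain ⟨v, -, rfl⟩ := Finset.mem_image.mp hp
      exact ⟨_, _, rfl, .inr ⟨rfl, rfl⟩⟩
    · rintro (u | u | ⟨e, i⟩) (v | v | ⟨f, j⟩) h - <;> simp only [R6] at h <;>
        simp only [coverHom] <;> grind
    · rintro (u | u | ⟨e, i⟩) (v | v | ⟨f, j⟩) h hS <;> simp only [B6] at h
      · subst h
        have hu : u ∉ C := fun hu => hS (Finset.mem_image_of_mem _ hu)
        simp [coverHom, hu]
      · subst h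
        have hu : u ∉ C := fun hu =>
          hS (Sym2.eq_swap (a := Sum.inr (Sum.inl u)) ▸ Finset.mem_image_of_mem _ hu)
        simp [coverHom, hu]
      · simp only [coverHom]
        grind
  · rintro ⟨S, hSk, -, φ, hR, hB⟩
    obtain ⟨C, hCS, hC⟩ := exists_cover_of_deletion G S φ hR hB
    exact ⟨C, hCS.trans hSk, hC⟩
end

section
/- Let G be a finite simple graph and k a natural number. Let G' be the 2-edge-coloured graph with vertex set V(G) ⊎ {v' : v ∈ V(G)}, whose red edges are: uv for every edge uv ∈ E(G), and a red loop at each vertex v'; and whose blue edges are: vv' for every v ∈ V(G). Then G has a vertex cover of size at most k if and only if there is a set S ⊆ V(G') with |S| ≤ k such that switch(G', S) admits a homomorphism to H^{2b}_{r,-}. -/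
/-- Red edges of the gadget graph `G'` of Statement 7: a red copy of each edge of
`G` (on the `Sum.inl` vertices) and a red loop at each primed vertex `v'`
(`Sum.inr v`). -/
def R7 {V : Type} (G : SimpleGraph V) : (V ⊕ V) → (V ⊕ V) → Prop
  | Sum.inl u, Sum.inl v => G.Adj u v
  | Sum.inr u, Sum.inr v => u = v
  | _, _ => False

/-- Blue edges of the gadget graph `G'` of Statement 7: a blue edge `v v'` for
each vertex `v` of `G`. -/
def B7 {V : Type} : (V ⊕ V) → (V ⊕ V) → Prop
  | Sum.inl u, Sum.inr v => u = v
  | Sum.inr u, Sum.inl v => u = v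
  | _, _ => False

/-- Given the red relation `X` and blue relation `Y` of a 2-edge-coloured graph
and a set `S` of vertices, `switchRel X Y S` is the red relation of the graph
switched at `S`: `uv` is red after switching iff it was red and not exactly one of
`u, v` lies in `S`, or it was blue and exactly one of `u, v` lies in `S`.
(The blue relation of the switched graph is `switchRel Y X S`.) -/
def switchRel {W : Type} (X Y : W → W → Prop) (S : Set W) (u v : W) : Prop :=
  (X u v ∧ ((u ∈ S) ↔ (v ∈ S))) ∨ (Y u v ∧ ¬((u ∈ S) ↔ (v ∈ S)))

/-- `G` has a vertex cover of size at most `k` iff one can switch the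
gadget graph `G'` at a set `S` of at most `k` vertices so that the resulting graph
admits a homomorphism to `H^{2b}_{r,-}` (red loop at `0`, blue edge between `0`
and `1`, no other edges). -/
theorem stmt7 (V : Type) [Fintype V] [DecidableEq V] (G : SimpleGraph V) (k : ℕ) :
    (∃ C : Finset V, C.card ≤ k ∧ ∀ u v, G.Adj u v → u ∈ C ∨ v ∈ C) ↔
      (∃ S : Finset (V ⊕ V), S.card ≤ k ∧
        ∃ φ : (V ⊕ V) → Fin 2,
          (∀ x y, switchRel (R7 G) B7 (↑S) x y → φ x = 0 ∧ φ y = 0) ∧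
          (∀ x y, switchRel B7 (R7 G) (↑S) x y →
            ((φ x = 0 ∧ φ y = 1) ∨ (φ x = 1 ∧ φ y = 0)))) := by
  constructor
  · rintro ⟨C, hk, hC⟩
    refine ⟨C.map Function.Embedding.inl, by simpa using hk,
      Sum.elim (fun v => if v ∈ C then 0 else 1) (fun _ => 0), ?_, ?_⟩
    · rintro (x | x) (y | y) h <;> simp [switchRel, R7, B7] at h ⊢
      · have := hC x y h.1
        tauto
      · obtain ⟨rfl, h⟩ := h
        exact h
      · obtain ⟨rfl, h⟩ := h
        exact h
    · rintro (x | x) (y | y) h <;> simp [switchRel, R7, B7] at h ⊢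
      · tauto
      · obtain ⟨rfl, h⟩ := h
        exact h
      · obtain ⟨rfl, h⟩ := h
        exact h
  · rintro ⟨S, hk, φ, hR, hB⟩
    refine ⟨S.image (Sum.elim id id), Finset.card_image_le.trans hk, fun u v huv => ?_⟩
    by_contra! h
    simp only [Finset.mem_image, Sum.exists, Sum.elim_inl, Sum.elim_inr, id, exists_eq_right,
      not_or] at h
    obtain ⟨⟨hu, hu'⟩, hv, -⟩ := h
    have edge := hR (Sum.inl u) (Sum.inl v) (by simp [switchRel, R7, huv, hu, hv])
    have loop := hR (Sum.inr u) (Sum.inr u) (by simp [switchRel, R7])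
    have pendant := hB (Sum.inl u) (Sum.inr u) (by simp [switchRel, B7, hu, hu'])
    simp [edge.1, loop.1] at pendant
end

section
/- Let F be a 2-CNF formula over a variable set X whose clauses are partitioned into groups g_1, …, g_p, where each group g_i contains a variable occurring in every clause of g_i. Construct a 2-CNF formula F' over the variable set X × {1,…,p} as follows: for each i and each clause c ∈ g_i, F' contains the clause obtained from c by replacing every variable x by (x,i); in addition, for every x ∈ X and all 1 ≤ i < j ≤ p, F' contains the clauses (¬(x,i) ∨ (x,j)) and ((x,i) ∨ ¬(x,j)). Then for every natural number k the following are equivalent: (a) there is a set I of at most k groups such that the set of clauses of F belonging to no group of I is satisfiable; (b) there is a set Y of at most k variables of F' such that the set of clauses of F' containing no variable of Y is satisfiable. -/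
/-- A truth assignment `α` satisfies a clause (a list of literals, each literal
being a variable together with its polarity) if it makes some literal true. -/
def SatClause {V : Type} (α : V → Bool) (c : List (V × Bool)) : Prop :=
  ∃ l ∈ c, α l.1 = l.2

/-- The clauses of the formula `F'` of Statement 8: for each group `g i` and each
clause `c ∈ g i`, the clause `c` with every variable `x` replaced by `(x, i)`;
and, for every variable `x` and all `i < j`, the two clauses
`(¬(x,i) ∨ (x,j))` and `((x,i) ∨ ¬(x,j))`. -/
def IsClauseF' {X : Type} {p : ℕ} (g : Fin p → Finset (List (X × Bool)))
    (c' : List ((X × Fin p) × Bool)) : Prop :=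
  (∃ i : Fin p, ∃ c ∈ g i, c' = c.map (fun l => ((l.1, i), l.2))) ∨
  (∃ (x : X) (i j : Fin p), i < j ∧
    (c' = [((x, i), false), ((x, j), true)] ∨
     c' = [((x, i), true), ((x, j), false)]))

/-- Over the indices `i` none of whose copies `(x, i)` is deleted, an assignment satisfying the
surviving clauses of `F'` takes the same value on all copies of a variable. -/
lemma copies_agree {X : Type} {p : ℕ} {g : Fin p → Finset (List (X × Bool))}
    {Y : Finset (X × Fin p)} {β : (X × Fin p) → Bool}
    (hβ : ∀ c', IsClauseF' g c' → (∀ l ∈ c', l.1 ∉ Y) → SatClause β c')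
    {i j : Fin p} (hi : ∀ x, (x, i) ∉ Y) (hj : ∀ x, (x, j) ∉ Y) (x : X) :
    β (x, i) = β (x, j) := by
  wlog hij : i < j generalizing i j
  · rcases (not_lt.mp hij).lt_or_eq with h | h
    · exact (this hj hi h).symm
    · rw [h]
  have h₁ := hβ _ (Or.inr ⟨x, i, j, hij, Or.inl rfl⟩) (by simp [hi, hj])
  have h₂ := hβ _ (Or.inr ⟨x, i, j, hij, Or.inr rfl⟩) (by simp [hi, hj])
  simp only [SatClause, List.mem_cons, List.not_mem_nil, or_false, exists_eq_or_imp,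
    exists_eq_left] at h₁ h₂
  grind

/-- Let the clauses of a 2-CNF formula `F` be partitioned into groups
`g 0, …, g (p-1)`, each group having a variable occurring in all of its clauses.
Then one can delete at most `k` groups from `F` to make it satisfiable iff one can
delete at most `k` variables (together with every clause containing them) from the
formula `F'` to make it satisfiable. -/
theorem stmt8 (X : Type) [DecidableEq X] (p : ℕ)
    (g : Fin p → Finset (List (X × Bool)))
    (h2 : ∀ i : Fin p, ∀ c ∈ g i, c.length ≤ 2)
    (hdisj : ∀ i j : Fin p, i ≠ j → ∀ c, c ∈ g i → c ∉ g j)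
    (hcommon : ∀ i : Fin p, ∃ x : X, ∀ c ∈ g i, ∃ b : Bool, (x, b) ∈ c)
    (k : ℕ) :
    (∃ I : Finset (Fin p), I.card ≤ k ∧
        ∃ α : X → Bool, ∀ i : Fin p, i ∉ I → ∀ c ∈ g i, SatClause α c) ↔
      (∃ Y : Finset (X × Fin p), Y.card ≤ k ∧
        ∃ β : (X × Fin p) → Bool, ∀ c' : List ((X × Fin p) × Bool),
          IsClauseF' g c' → (∀ l ∈ c', l.1 ∉ Y) → SatClause β c') := by
  constructor
  · rintro ⟨I, hI, α, hα⟩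
    choose v hv using hcommon
    refine ⟨I.image fun i => (v i, i), Finset.card_image_le.trans hI, fun y => α y.1, ?_⟩
    rintro _ (⟨i, c, hc, rfl⟩ | ⟨x, i, j, -, rfl | rfl⟩) hY
    · have hi : i ∉ I := by
        intro hi
        obtain ⟨b, hb⟩ := hv i c hc
        exact hY _ (List.mem_map_of_mem hb) (Finset.mem_image_of_mem _ hi)
      obtain ⟨l, hl, hαl⟩ := hα i hi c hc
      exact ⟨_, List.mem_map_of_mem hl, hαl⟩
    all_goals cases h : α x <;> simp [SatClause, h]
  · rintro ⟨Y, hY, β, hβ⟩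
    refine ⟨Y.image Prod.snd, Finset.card_image_le.trans hY, ?_⟩
    have hfree : ∀ i ∉ Y.image Prod.snd, ∀ x, (x, i) ∉ Y :=
      fun i hi x hx => hi (Finset.mem_image_of_mem Prod.snd hx)
    by_cases hex : ∃ i₀, i₀ ∉ Y.image Prod.snd
    · obtain ⟨i₀, hi₀⟩ := hex
      refine ⟨fun x => β (x, i₀), fun i hi c hc => ?_⟩
      obtain ⟨_, hl', hβl⟩ := hβ _ (Or.inl ⟨i, c, hc, rfl⟩) (by
        intro _ hl
        obtain ⟨l, -, rfl⟩ := List.mem_map.mp hl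
        exact hfree i hi l.1)
      obtain ⟨l, hl, rfl⟩ := List.mem_map.mp hl'
      exact ⟨l, hl, (copies_agree hβ (hfree i₀ hi₀) (hfree i hi) l.1).trans hβl⟩
    · exact ⟨fun _ => true, fun i hi => (hex ⟨i, hi⟩).elim⟩
end

section
/- For every 2-edge-coloured graph G and every set S ⊆ V(G), the graph switch(G, S) admits a homomorphism to H^{2b}_{r,r} if and only if G admits a homomorphism to H^{2b}_{r,r}. -/
/-- For every 2-edge-coloured graph `G` and every `S ⊆ V(G)`,
`switch (G, S)` admits a homomorphism to `H^{2b}_{r,r}` (red loops at `0` and `1`,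
blue edge between `0` and `1`, no other edges) iff `G` does. -/
theorem stmt11 (W : Type) [Fintype W] (R B : W → W → Prop)
    (hR : Symmetric R) (hB : Symmetric B) (S : Set W) :
    (∃ φ : W → Fin 2,
        (∀ u v, switchRel R B S u v → ((φ u = 0 ∧ φ v = 0) ∨ (φ u = 1 ∧ φ v = 1))) ∧
        (∀ u v, switchRel B R S u v → ((φ u = 0 ∧ φ v = 1) ∨ (φ u = 1 ∧ φ v = 0)))) ↔
      (∃ φ : W → Fin 2,
        (∀ u v, R u v → ((φ u = 0 ∧ φ v = 0) ∨ (φ u = 1 ∧ φ v = 1))) ∧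
        (∀ u v, B u v → ((φ u = 0 ∧ φ v = 1) ∨ (φ u = 1 ∧ φ v = 0)))) := by
  classical
  have zero_or_one : ∀ a : Fin 2, a = 0 ∨ a = 1 := by decide
  constructor
  · rintro ⟨φ, hred, hblue⟩
    refine ⟨fun w => if w ∈ S then 1 - φ w else φ w, fun u v h => ?_, fun u v h => ?_⟩ <;>
    · have hr := hred u v
      have hb := hblue u v
      unfold switchRel at hr hb
      by_cases hu : u ∈ S <;> by_cases hv : v ∈ S <;>
        rcases zero_or_one (φ u) with h₁ | h₁ <;> rcases zero_or_one (φ v) with h₂ | h₂ <;>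
        simp_all
  · rintro ⟨φ, hred, hblue⟩
    refine ⟨fun w => if w ∈ S then 1 - φ w else φ w, fun u v h => ?_, fun u v h => ?_⟩ <;>
    · have hr := hred u v
      have hb := hblue u v
      unfold switchRel at h
      by_cases hu : u ∈ S <;> by_cases hv : v ∈ S <;>
        rcases zero_or_one (φ u) with h₁ | h₁ <;> rcases zero_or_one (φ v) with h₂ | h₂ <;>
        simp_all
end

section
/- Let q ≥ 1 and let C be the 2-edge-coloured graph consisting of an all-blue cycle c_0, c_1, …, c_{2q}, c_0 of length 2q+1 (blue edges c_i c_{i+1} for 0 ≤ i ≤ 2q−1 and c_{2q} c_0, no red edges). Then: (i) C admits no homomorphism to H^{2rb}_{r,r}; and (ii) for every nonempty subset T ⊆ {c_0, c_q}, the graph switch(C, T) admits a homomorphism to H^{2rb}_{r,r}. -/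
/-- The adjacency relation of a cycle on `ZMod m` (vertex `i` adjacent to `i ± 1`). -/
def cycleAdj (m : ℕ) (i j : ZMod m) : Prop := j = i + 1 ∨ i = j + 1

/-- A nonempty set of residues that is stable under `x ↦ x + 1` is everything. -/
theorem mem_of_forall_mem_add_one {m : ℕ} [NeZero m] {T : Set (ZMod m)} (hT : T.Nonempty)
    (h : ∀ w ∈ T, w + 1 ∈ T) (x : ZMod m) : x ∈ T := by
  obtain ⟨t, ht⟩ := hT
  have shift : ∀ n : ℕ, t + (n : ZMod m) ∈ T := by
    intro n
    induction n with
    | zero => simpa using ht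
    | succ n ih => simpa [add_assoc] using h _ ih
  simpa using shift (x - t).val

/-- A map to `Fin 2` that alternates along `x ↦ x + 1` exists only for cycles of even length. -/
theorem not_forall_ne_add_one_of_odd {m : ℕ} (hm : Odd m) (φ : ZMod m → Fin 2) :
    ¬ ∀ x, φ x ≠ φ (x + 1) := by
  intro h
  have parity : ∀ n : ℕ, φ n = φ 0 ↔ Even n := by
    intro n
    induction n with
    | zero => simp
    | succ n ih =>
      have hn := h n
      rw [Nat.even_add_one, ← ih]
      push_cast
      omega
  have hφ := parity m
  rw [ZMod.natCast_self] at hφ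
  exact Nat.not_even_iff_odd.mpr hm (hφ.mp rfl)

/-- Removing a single edge `w (w + 1)` from a cycle makes it properly 2-colourable. -/
theorem exists_ne_add_one_of_ne {m : ℕ} [NeZero m] (w : ZMod m) :
    ∃ φ : ZMod m → Fin 2, ∀ x, x ≠ w → φ x ≠ φ (x + 1) := by
  refine ⟨fun x => Fin.ofNat 2 (x - (w + 1)).val, fun x hx => ?_⟩
  have hval : (x - (w + 1) + 1).val = (x - (w + 1)).val + 1 := by
    have hlt := ZMod.val_lt (x - (w + 1))
    have hne : (x - (w + 1)).val + 1 ≠ m := by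
      intro he
      have hc := congrArg (Nat.cast : ℕ → ZMod m) he
      push_cast at hc
      rw [ZMod.natCast_zmod_val, ZMod.natCast_self] at hc
      exact hx (by linear_combination hc)
    rw [← ZMod.val_natCast_of_lt (show (x - (w + 1)).val + 1 < m by omega)]
    push_cast
    rw [ZMod.natCast_zmod_val]
  have hsub : x + 1 - (w + 1) = x - (w + 1) + 1 := by ring
  simp only [hsub, hval, ne_eq, Fin.ext_iff, Fin.val_ofNat]
  omega

/-- Let `C` be the all-blue cycle of odd length `2q+1` (vertices
`ZMod (2q+1)`, blue edges `i (i+1)`, no red edges).  Then (i) `C` admits no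
homomorphism to `H^{2rb}_{r,r}` (red loops at `0` and `1`, both a red and a blue
edge between `0` and `1`); and (ii) for every nonempty `T ⊆ {c_0, c_q}`,
`switch (C, T)` admits a homomorphism to `H^{2rb}_{r,r}`. -/
theorem stmt16 (q : ℕ) (hq : 1 ≤ q) :
    (¬ ∃ φ : ZMod (2 * q + 1) → Fin 2,
        (∀ u v, (False : Prop) →
          ((φ u = 0 ∧ φ v = 0) ∨ (φ u = 1 ∧ φ v = 1) ∨
           (φ u = 0 ∧ φ v = 1) ∨ (φ u = 1 ∧ φ v = 0))) ∧
        (∀ u v, cycleAdj (2 * q + 1) u v →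
          ((φ u = 0 ∧ φ v = 1) ∨ (φ u = 1 ∧ φ v = 0)))) ∧
    (∀ T : Set (ZMod (2 * q + 1)),
      T ⊆ {(0 : ZMod (2 * q + 1)), ((q : ℕ) : ZMod (2 * q + 1))} → T.Nonempty →
      ∃ φ : ZMod (2 * q + 1) → Fin 2,
        (∀ u v, switchRel (fun _ _ => False) (cycleAdj (2 * q + 1)) T u v →
          ((φ u = 0 ∧ φ v = 0) ∨ (φ u = 1 ∧ φ v = 1) ∨
           (φ u = 0 ∧ φ v = 1) ∨ (φ u = 1 ∧ φ v = 0))) ∧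
        (∀ u v, switchRel (cycleAdj (2 * q + 1)) (fun _ _ => False) T u v →
          ((φ u = 0 ∧ φ v = 1) ∨ (φ u = 1 ∧ φ v = 0)))) := by
  refine ⟨?_, fun T hT hne => ?_⟩
  · rintro ⟨φ, -, hφ⟩
    refine not_forall_ne_add_one_of_odd (odd_two_mul_add_one q) φ fun x => ?_
    have := hφ x (x + 1) (Or.inl rfl)
    omega
  · have hneg : (-1 : ZMod (2 * q + 1)) ∉ T := by
      intro hmem
      have hdvd : ∀ n : ℕ, (n : ZMod (2 * q + 1)) = -1 → 2 * q + 1 ≤ n + 1 := by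
        intro n hn
        refine Nat.le_of_dvd n.succ_pos ((ZMod.natCast_eq_zero_iff _ _).mp ?_)
        rw [Nat.cast_succ, hn, neg_add_cancel]
      rcases hT hmem with h | h
      · have := hdvd 0 (by rw [Nat.cast_zero, h])
        omega
      · have := hdvd q (Eq.symm h)
        omega
    obtain ⟨w, hw, hw'⟩ : ∃ w ∈ T, w + 1 ∉ T := by
      by_contra! h
      exact hneg (mem_of_forall_mem_add_one hne h _)
    obtain ⟨φ, hφ⟩ := exists_ne_add_one_of_ne w
    refine ⟨φ, fun u v _ => by omega, fun u v huv => ?_⟩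
    obtain ⟨rfl | rfl, hiff⟩ | ⟨hf, -⟩ := huv
    · have := hφ u (by rintro rfl; exact hw' (hiff.mp hw))
      omega
    · have := hφ v (by rintro rfl; exact hw' (hiff.mpr hw))
      omega
    · exact hf.elim
end

section
/- Let L ≥ 4 be even and m ≥ 1 be such that L/2 + m is odd. Let P be the 2-edge-coloured graph consisting of an all-blue cycle u_0, u_1, …, u_{L-1}, u_0 of length L together with an all-blue path w_0, w_1, …, w_m of length m with w_0 = u_0 and w_m = u_{L/2}, whose internal vertices w_1, …, w_{m-1} are new and distinct (P has no red edges). Then: (i) P admits no homomorphism to H^{2rb}_{r,r}; and (ii) for every vertex v of P, the graph switch(P, {v}) admits a homomorphism to H^{2rb}_{r,r} if and only if v ∈ {w_0, w_1, …, w_m}. -/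
/-- The vertices `w_0, w_1, …, w_m` of the chord path of Statement 17:
`w_0 = u_0`, `w_m = u_{L/2}` (vertices of the cycle `ZMod L`), and
`w_1, …, w_{m-1}` are new internal vertices (the elements of `Fin (m-1)`). -/
def pathVert (L m : ℕ) (i : Fin (m + 1)) : ZMod L ⊕ Fin (m - 1) :=
  if h0 : (i : ℕ) = 0 then Sum.inl 0
  else if hm : (i : ℕ) = m then Sum.inl ((L / 2 : ℕ) : ZMod L)
  else Sum.inr ⟨(i : ℕ) - 1, by have := i.isLt; omega⟩

/-- The blue edges of the graph `P` of Statement 17: the all-blue cycle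
`u_0, …, u_{L-1}` on `ZMod L` together with the all-blue path
`w_0, w_1, …, w_m`. -/
def B17 (L m : ℕ) (x y : ZMod L ⊕ Fin (m - 1)) : Prop :=
  (∃ i j : ZMod L, x = Sum.inl i ∧ y = Sum.inl j ∧ (j = i + 1 ∨ i = j + 1)) ∨
  (∃ i : Fin m,
    (x = pathVert L m i.castSucc ∧ y = pathVert L m i.succ) ∨
    (y = pathVert L m i.castSucc ∧ x = pathVert L m i.succ))

theorem blue_edge_iff_ne (a b : Fin 2) : ((a = 0 ∧ b = 1) ∨ (a = 1 ∧ b = 0)) ↔ a ≠ b := by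
  revert a b; decide

/-- An alternating sequence of two colours returns to its first colour exactly at even steps. -/
theorem eq_start_iff_even_of_alternating (f : ℕ → Fin 2) (n : ℕ)
    (h : ∀ k < n, f k ≠ f (k + 1)) : f n = f 0 ↔ Even n := by
  induction n with
  | zero => simp
  | succ n ih =>
    have ih' := ih fun k hk => h k (by omega)
    have hn := h n (by omega)
    rw [Nat.even_add_one, ← ih']
    exact (by decide : ∀ a b c : Fin 2, a ≠ b → (b = c ↔ ¬ a = c)) _ _ _ hn

theorem pathVert_zero (L m : ℕ) : pathVert L m 0 = Sum.inl 0 := by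
  simp [pathVert]

theorem pathVert_last (L m : ℕ) (hm : 1 ≤ m) :
    pathVert L m (Fin.last m) = Sum.inl ((L / 2 : ℕ) : ZMod L) := by
  have : m ≠ 0 := by omega
  simp [pathVert, this]

theorem natCast_ne_zero_of_lt {L a : ℕ} (h0 : 0 < a) (ha : a < L) : (a : ZMod L) ≠ 0 := by
  rw [Ne, ZMod.natCast_eq_zero_iff]
  exact fun h => absurd (Nat.le_of_dvd h0 h) (by omega)

theorem pathVert_injective (L m : ℕ) (hL : 4 ≤ L) : Function.Injective (pathVert L m) := by
  intro i j hij
  have hne : ((L / 2 : ℕ) : ZMod L) ≠ 0 := natCast_ne_zero_of_lt (by omega) (by omega)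
  have hi := i.isLt
  have hj := j.isLt
  ext
  unfold pathVert at hij
  split_ifs at hij
  all_goals first
    | omega
    | exact absurd (Sum.inl.inj hij) hne
    | exact absurd (Sum.inl.inj hij).symm hne
    | (simp only [Sum.inr.injEq, Fin.mk.injEq] at hij; omega)

theorem not_B17_self (L m : ℕ) (hL : 4 ≤ L) (v : ZMod L ⊕ Fin (m - 1)) : ¬ B17 L m v v := by
  have h1 : ((1 : ℕ) : ZMod L) ≠ 0 := natCast_ne_zero_of_lt (by omega) (by omega)
  rintro (⟨i, j, hi, hj, h⟩ | ⟨i, h⟩)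
  · obtain rfl : i = j := Sum.inl.inj (hi.symm.trans hj)
    simp at h h1
    exact h1 h
  · have hp : pathVert L m i.castSucc = pathVert L m i.succ := by
      rcases h with ⟨h, h'⟩ | ⟨h, h'⟩ <;> exact h.symm.trans h'
    exact absurd (pathVert_injective L m hL hp) (Fin.castSucc_lt_succ).ne

/-- The chord path together with a cycle arc joining its ends has odd length, so it has no
proper 2-colouring. -/
theorem no_alternating_path_and_arc (L m : ℕ) (hm : 1 ≤ m) (hodd : Odd (L / 2 + m))
    (φ : ZMod L ⊕ Fin (m - 1) → Fin 2)
    (hpath : ∀ i : Fin m, φ (pathVert L m i.castSucc) ≠ φ (pathVert L m i.succ))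
    (g : ℕ → ZMod L) (hg0 : g 0 = 0) (hg : g (L / 2) = ((L / 2 : ℕ) : ZMod L))
    (harc : ∀ k < L / 2, φ (Sum.inl (g k)) ≠ φ (Sum.inl (g (k + 1)))) : False := by
  have harcEven := eq_start_iff_even_of_alternating (fun k => φ (Sum.inl (g k))) (L / 2) harc
  have hpathEven := eq_start_iff_even_of_alternating
    (fun k => φ (pathVert L m (Fin.ofNat (m + 1) k))) m (by
      intro k hk
      have h := hpath ⟨k, hk⟩
      have e1 : Fin.ofNat (m + 1) k = (⟨k, hk⟩ : Fin m).castSucc := by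
        ext; simp; omega
      have e2 : Fin.ofNat (m + 1) (k + 1) = (⟨k, hk⟩ : Fin m).succ := by
        ext; simp; omega
      simpa only [e1, e2] using h)
  have e0 : Fin.ofNat (m + 1) 0 = 0 := rfl
  have em : Fin.ofNat (m + 1) m = Fin.last m := by ext; simp
  simp only [e0, em, pathVert_zero, pathVert_last L m hm] at hpathEven
  simp only [hg0, hg] at harcEven
  rw [← Nat.not_even_iff_odd, Nat.even_add, ← harcEven, ← hpathEven] at hodd
  exact hodd Iff.rfl

theorem B17_pathVert (L m : ℕ) (i : Fin m) :
    B17 L m (pathVert L m i.castSucc) (pathVert L m i.succ) :=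
  Or.inr ⟨i, Or.inl ⟨rfl, rfl⟩⟩

theorem B17_cycle (L m : ℕ) {i j : ZMod L} (h : j = i + 1 ∨ i = j + 1) :
    B17 L m (Sum.inl i) (Sum.inl j) :=
  Or.inl ⟨i, j, rfl, rfl, h⟩

theorem neg_half (L : ℕ) (hL : Even L) : -((L / 2 : ℕ) : ZMod L) = ((L / 2 : ℕ) : ZMod L) := by
  rw [neg_eq_iff_add_eq_zero, ← Nat.cast_add, ZMod.natCast_eq_zero_iff]
  obtain ⟨r, rfl⟩ := hL
  exact dvd_of_eq (by omega)

/-- A colouring of `P` that is proper off `v` forces `v` to lie on the chord path. -/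
theorem exists_eq_pathVert_of_coloring (L m : ℕ) (hL4 : 4 ≤ L) (hLeven : Even L) (hm : 1 ≤ m)
    (hodd : Odd (L / 2 + m)) (v : ZMod L ⊕ Fin (m - 1)) (φ : ZMod L ⊕ Fin (m - 1) → Fin 2)
    (hφ : ∀ a b, B17 L m a b → a ≠ v → b ≠ v → φ a ≠ φ b) :
    ∃ i : Fin (m + 1), v = pathVert L m i := by
  by_contra hv
  push Not at hv
  have hpath : ∀ i : Fin m, φ (pathVert L m i.castSucc) ≠ φ (pathVert L m i.succ) :=
    fun i => hφ _ _ (B17_pathVert L m i) (hv _).symm (hv _).symm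
  rcases v with j | k
  · have : NeZero L := ⟨by omega⟩
    have hval := ZMod.val_lt j
    have hcast : ((j.val : ℕ) : ZMod L) = j := ZMod.natCast_zmod_val j
    have hmid : j.val ≠ L / 2 := by
      intro h
      apply hv (Fin.last m)
      rw [pathVert_last L m hm, ← h, hcast]
    have hpos : j ≠ 0 := by
      rintro rfl
      exact hv 0 (pathVert_zero L m).symm
    by_cases hlt : j.val < L / 2
    · have hne : ∀ k ≤ L / 2, (Sum.inl (-(k : ZMod L)) : ZMod L ⊕ Fin (m - 1)) ≠ Sum.inl j := by
        intro k hk h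
        have h' := Sum.inl.inj h
        rw [← hcast, neg_eq_iff_add_eq_zero, ← Nat.cast_add] at h'
        have : j.val ≠ 0 := by simpa [ZMod.val_eq_zero] using hpos
        exact natCast_ne_zero_of_lt (by omega) (by omega) h'
      refine no_alternating_path_and_arc L m hm hodd φ hpath (fun k => -(k : ZMod L)) (by simp)
        (neg_half L hLeven) fun k hk => ?_
      refine hφ _ _ (B17_cycle L m (Or.inr ?_)) (hne k hk.le) (hne (k + 1) hk)
      push_cast; ring
    · have hne : ∀ k ≤ L / 2, (Sum.inl (k : ZMod L) : ZMod L ⊕ Fin (m - 1)) ≠ Sum.inl j := by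
        intro k hk h
        have h' := Sum.inl.inj h
        rw [← h', ZMod.val_natCast_of_lt (by omega)] at hmid hlt
        omega
      refine no_alternating_path_and_arc L m hm hodd φ hpath (fun k => (k : ZMod L)) (by simp)
        rfl fun k hk => ?_
      refine hφ _ _ (B17_cycle L m (Or.inl ?_)) (hne k hk.le) (hne (k + 1) hk)
      push_cast; ring
  · have hk := k.isLt
    apply hv ⟨k + 1, by omega⟩
    have : (k : ℕ) + 1 ≠ m := by omega
    simp [pathVert, this]

/-- The parity colouring of `P`, with the two colours exchanged on the chord path from
position `i` on. -/
def chordColoring (L m : ℕ) (hL : 2 ∣ L) (i : ℕ) : ZMod L ⊕ Fin (m - 1) → ZMod 2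
  | Sum.inl j => ZMod.castHom hL (ZMod 2) j
  | Sum.inr k => if (k : ℕ) + 1 < i then ((k + 1 : ℕ) : ZMod 2) else ((k + 1 + 1 : ℕ) : ZMod 2)

theorem chordColoring_pathVert (L m : ℕ) (hL : 2 ∣ L) (hodd : Odd (L / 2 + m))
    (i t : Fin (m + 1)) (hti : t ≠ i) :
    chordColoring L m hL i (pathVert L m t) =
      if t < i then ((t : ℕ) : ZMod 2) else (((t : ℕ) + 1 : ℕ) : ZMod 2) := by
  have hti' : (t : ℕ) ≠ i := fun h => hti (Fin.ext h)
  have hi := i.isLt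
  simp only [Fin.lt_def]
  unfold pathVert
  split_ifs with h0 hlt hm hlt
  · simp [chordColoring, h0]
  · omega
  · omega
  · obtain ⟨r, hr⟩ := hodd
    simp only [chordColoring, map_natCast, ZMod.natCast_eq_natCast_iff, Nat.ModEq]
    omega
  all_goals
    have : (t : ℕ) - 1 + 1 = t := by omega
    simp [chordColoring, *]

theorem chordColoring_ne (L m : ℕ) (hL : 2 ∣ L) (hodd : Odd (L / 2 + m)) (i : Fin (m + 1))
    (a b : ZMod L ⊕ Fin (m - 1)) (hab : B17 L m a b) (ha : a ≠ pathVert L m i)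
    (hb : b ≠ pathVert L m i) : chordColoring L m hL i a ≠ chordColoring L m hL i b := by
  have hsucc : ∀ x : ZMod 2, x ≠ x + 1 := by decide
  have hedge : ∀ t : Fin m, pathVert L m t.castSucc ≠ pathVert L m i →
      pathVert L m t.succ ≠ pathVert L m i →
      chordColoring L m hL i (pathVert L m t.castSucc) ≠
        chordColoring L m hL i (pathVert L m t.succ) := by
    intro t h h'
    have h1 : t.castSucc ≠ i := fun e => h (by rw [e])
    have h2 : t.succ ≠ i := fun e => h' (by rw [e])
    have h3 : t.castSucc < i ↔ t.succ < i := by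
      simp only [Fin.lt_def, Fin.ext_iff, Ne, Fin.val_castSucc, Fin.val_succ] at h1 h2 ⊢
      omega
    rw [chordColoring_pathVert L m hL hodd i _ h1, chordColoring_pathVert L m hL hodd i _ h2]
    simp only [h3, Fin.val_castSucc, Fin.val_succ]
    split_ifs
    all_goals
      push_cast
      exact hsucc _
  rcases hab with ⟨p, q, rfl, rfl, rfl | rfl⟩ | ⟨t, ⟨rfl, rfl⟩ | ⟨rfl, rfl⟩⟩
  · simpa only [chordColoring, map_add, map_one] using hsucc _
  · simpa only [chordColoring, map_add, map_one] using (hsucc _).symm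
  · exact hedge t ha hb
  · exact (hedge t hb ha).symm

/-- Let `L ≥ 4` be even and `m ≥ 1` with `L/2 + m` odd, and let `P`
be the all-blue graph consisting of a cycle of length `L` and a chord path of
length `m` between two antipodal vertices.  Then (i) `P` admits no homomorphism to
`H^{2rb}_{r,r}` (red loops at `0` and `1`, both a red and a blue edge between `0`
and `1`); and (ii) for every vertex `v` of `P`, `switch (P, {v})` admits a
homomorphism to `H^{2rb}_{r,r}` iff `v` is one of `w_0, …, w_m`. -/
theorem stmt17 (L m : ℕ) (hL4 : 4 ≤ L) (hLeven : Even L) (hm : 1 ≤ m)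
    (hodd : Odd (L / 2 + m)) :
    (¬ ∃ φ : ZMod L ⊕ Fin (m - 1) → Fin 2,
        (∀ u v, (False : Prop) →
          ((φ u = 0 ∧ φ v = 0) ∨ (φ u = 1 ∧ φ v = 1) ∨
           (φ u = 0 ∧ φ v = 1) ∨ (φ u = 1 ∧ φ v = 0))) ∧
        (∀ u v, B17 L m u v → ((φ u = 0 ∧ φ v = 1) ∨ (φ u = 1 ∧ φ v = 0)))) ∧
    (∀ v : ZMod L ⊕ Fin (m - 1),
      (∃ φ : ZMod L ⊕ Fin (m - 1) → Fin 2,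
        (∀ a b, switchRel (fun _ _ => False) (B17 L m) ({v} : Set _) a b →
          ((φ a = 0 ∧ φ b = 0) ∨ (φ a = 1 ∧ φ b = 1) ∨
           (φ a = 0 ∧ φ b = 1) ∨ (φ a = 1 ∧ φ b = 0))) ∧
        (∀ a b, switchRel (B17 L m) (fun _ _ => False) ({v} : Set _) a b →
          ((φ a = 0 ∧ φ b = 1) ∨ (φ a = 1 ∧ φ b = 0)))) ↔
      (∃ i : Fin (m + 1), v = pathVert L m i)) := by
  refine ⟨?_, fun v => ⟨?_, ?_⟩⟩
  · rintro ⟨φ, -, hφ⟩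
    have hφ' : ∀ a b, B17 L m a b → φ a ≠ φ b :=
      fun a b h => (blue_edge_iff_ne _ _).1 (hφ a b h)
    refine no_alternating_path_and_arc L m hm hodd φ (fun i => hφ' _ _ (B17_pathVert L m i))
      (fun k => (k : ZMod L)) (by simp) rfl fun k _ => hφ' _ _ (B17_cycle L m (Or.inl ?_))
    push_cast; ring
  · rintro ⟨φ, -, hφ⟩
    refine exists_eq_pathVert_of_coloring L m hL4 hLeven hm hodd v φ fun a b hab ha hb => ?_
    exact (blue_edge_iff_ne _ _).1 (hφ a b (Or.inl ⟨hab, by simp [ha, hb]⟩))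
  · rintro ⟨i, rfl⟩
    refine ⟨chordColoring L m hLeven.two_dvd i, fun a b _ => ?_, fun a b h => ?_⟩
    · exact (by decide : ∀ x y : Fin 2, (x = 0 ∧ y = 0) ∨ (x = 1 ∧ y = 1) ∨
        (x = 0 ∧ y = 1) ∨ (x = 1 ∧ y = 0)) _ _
    · rcases h with ⟨hab, hS⟩ | ⟨h, -⟩
      · simp only [Set.mem_singleton_iff] at hS
        have ha : a ≠ pathVert L m i := by
          intro ha
          have hb := hS.1 ha
          subst ha hb
          exact not_B17_self L m hL4 _ hab
        exact (blue_edge_iff_ne _ _).2 (chordColoring_ne L m hLeven.two_dvd hodd i a b hab ha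
          fun hb => ha (hS.2 hb))
      · exact h.elim
end

section
/- Let G be a 2-edge-coloured graph containing a walk x_0, x_1, …, x_{2p+1} (p ≥ 1) such that x_0 x_1 and x_{2p} x_{2p+1} are red edges of G and x_i x_{i+1} is a blue edge of G for every 1 ≤ i ≤ 2p−1. Let S ⊆ V(G) be a set with S ∩ {x_0, x_1, x_{2p}, x_{2p+1}} = ∅. Then switch(G, S) contains a walk y_0, y_1, …, y_{2q+1} for some q ≥ 1 such that y_0 y_1 and y_{2q} y_{2q+1} are red edges of switch(G, S) and y_j y_{j+1} is a blue edge of switch(G, S) for every 1 ≤ j ≤ 2q−1. -/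
/-- Two red edges at even positive distance along a walk, with only blue edges strictly between
them, yield a walk of odd length whose first and last edges are red and whose other edges are
blue. -/
theorem exists_red_blue_red_walk {W : Type} {P Q : W → W → Prop} {x : ℕ → W} {a n : ℕ}
    (han : a < n) (hpar : Odd n ↔ Odd a) (ha : P (x a) (x (a + 1))) (hn : P (x n) (x (n + 1)))
    (hQ : ∀ j, a < j → j < n → Q (x j) (x (j + 1))) :
    ∃ (q : ℕ) (y : ℕ → W), 1 ≤ q ∧ P (y 0) (y 1) ∧ P (y (2 * q)) (y (2 * q + 1)) ∧
      ∀ j : ℕ, 1 ≤ j → j ≤ 2 * q - 1 → Q (y j) (y (j + 1)) := by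
  obtain ⟨q, rfl⟩ : ∃ q, n = a + 2 * q := ⟨(n - a) / 2, by grind⟩
  exact ⟨q, fun j => x (a + j), by lia, ha, hn, fun j h1 h2 => hQ (a + j) (by lia) (by lia)⟩

/-- If a 2-edge-coloured graph `G` contains a walk
`x 0, x 1, …, x (2p+1)` (with `p ≥ 1`) whose first and last edges are red and
whose middle `2p−1` edges are blue, and `S` is a set of vertices avoiding
`x 0, x 1, x (2p), x (2p+1)`, then `switch (G, S)` contains a walk
`y 0, …, y (2q+1)` (for some `q ≥ 1`) whose first and last edges are red and whose
middle `2q−1` edges are blue in `switch (G, S)`. -/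
theorem stmt18 (W : Type) [Fintype W] (R B : W → W → Prop)
    (hR : Symmetric R) (hB : Symmetric B)
    (p : ℕ) (hp : 1 ≤ p) (x : ℕ → W)
    (hfirst : R (x 0) (x 1)) (hlast : R (x (2 * p)) (x (2 * p + 1)))
    (hblue : ∀ i : ℕ, 1 ≤ i → i ≤ 2 * p - 1 → B (x i) (x (i + 1)))
    (S : Set W)
    (hS0 : x 0 ∉ S) (hS1 : x 1 ∉ S)
    (hS2 : x (2 * p) ∉ S) (hS3 : x (2 * p + 1) ∉ S) :
    ∃ (q : ℕ) (y : ℕ → W), 1 ≤ q ∧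
      switchRel R B S (y 0) (y 1) ∧
      switchRel R B S (y (2 * q)) (y (2 * q + 1)) ∧
      ∀ j : ℕ, 1 ≤ j → j ≤ 2 * q - 1 → switchRel B R S (y j) (y (j + 1)) := by
  by_contra hcon
  -- The last switched-red edge before `x n` has a position whose parity records if `x n ∈ S`.
  have key : ∀ n, 1 ≤ n → n ≤ 2 * p → ∃ a < n, switchRel R B S (x a) (x (a + 1)) ∧
      (∀ j, a < j → j < n → switchRel B R S (x j) (x (j + 1))) ∧ (x n ∈ S ↔ Odd a) := by
    intro n hn
    induction n, hn using Nat.le_induction with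
    | base =>
      intro _
      exact ⟨0, by lia, Or.inl ⟨hfirst, by simp [hS0, hS1]⟩, by lia, by simp [hS1]⟩
    | succ n hn ih =>
      intro hle
      obtain ⟨a, han, ha, hbl, hpar⟩ := ih (by lia)
      by_cases hc : x n ∈ S ↔ x (n + 1) ∈ S
      · refine ⟨a, by lia, ha, fun j h1 h2 => ?_, hc.symm.trans hpar⟩
        obtain h | rfl : j < n ∨ j = n := by lia
        · exact hbl j h1 h
        · exact Or.inl ⟨hblue j hn (by lia), hc⟩
      · have hrn : switchRel R B S (x n) (x (n + 1)) := Or.inr ⟨hblue n hn (by lia), hc⟩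
        have hodd : ¬(Odd n ↔ Odd a) := fun h =>
          hcon (exists_red_blue_red_walk han h ha hrn hbl)
        exact ⟨n, by lia, hrn, by lia, by tauto⟩
  obtain ⟨a, han, ha, hbl, hpar⟩ := key (2 * p) (by lia) le_rfl
  refine hcon (exists_red_blue_red_walk han ?_ ha (Or.inl ⟨hlast, by simp [hS2, hS3]⟩) hbl)
  simp [← hpar, hS2]
end
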